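/- Let (a_1,…,a_n) be a finite sequence of positive integers and let ω = [a_1,…,a_n,1,1,1,…]. For every ε > 0 there exists an integer m_0 > 0 such that for every m ≥ m_0 and every infinite tail of positive integers I = (b_{n+m}, b_{n+m+1}, …), the number β^I = [a_1,…,a_n,1,…,1,b_{n+m},b_{n+m+1},…], whose digits are a_1,…,a_n, then 1 in positions n+1 through n+m−1, and then the digits of I, satisfies Σ_{i=1}^{n+m−1} | α_1(β^I)⋯α_{i−1}(β^I)·log(1/α_i(β^I)) − α_1(ω)⋯α_{i−1}(ω)·log(1/α_i(ω)) | < ε. -/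

import Mathlib

open scoped Real ENNReal
open Filter

/-- The Gauss-map iterates: `alphaIter θ k` is `α_{k+1}(θ)`, i.e. `alphaIter θ 0 = α_1(θ) = θ`
and `α_{i+1}(θ)` is the fractional part of `1/α_i(θ)`. -/
noncomputable def alphaIter (θ : ℝ) : ℕ → ℝ
  | 0 => θ
  | k + 1 => Int.fract (1 / alphaIter θ k)

/-- `HasCF θ a` : `θ` is an irrational number in `(0,1)` whose continued fraction digits
are given by `a` (0-indexed: `a k` is the digit `a_{k+1}` in 1-indexed notation). -/
def HasCF (θ : ℝ) (a : ℕ → ℕ) : Prop :=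
  θ ∈ Set.Ioo (0 : ℝ) 1 ∧ Irrational θ ∧ ∀ k, ⌊1 / alphaIter θ k⌋ = (a k : ℤ)

/-- Yoccoz's Brjuno function `Φ(θ) = Σ_{n≥1} α_1(θ)⋯α_{n-1}(θ)·log(1/α_n(θ))`,
as a real-valued sum. -/
noncomputable def brjunoPhi (θ : ℝ) : ℝ :=
  ∑' k : ℕ, (∏ j ∈ Finset.range k, alphaIter θ j) * Real.log (1 / alphaIter θ k)

/-- Yoccoz's Brjuno function with values in `ℝ≥0∞` (all terms are nonnegative). -/
noncomputable def brjunoPhiE (θ : ℝ) : ℝ≥0∞ :=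
  ∑' k : ℕ, ENNReal.ofReal ((∏ j ∈ Finset.range k, alphaIter θ j) * Real.log (1 / alphaIter θ k))

/-- Digits of the noble number `ω = [a_1,…,a_n,1,1,1,…]`. -/
def nobleDigits (n : ℕ) (a : ℕ → ℕ) : ℕ → ℕ := fun k => if k < n then a k else 1

/-- Digits of `β^N = [a_1,…,a_n,1,…,1,N,1,1,…]`, with `N` in (1-indexed) position `n+m`. -/
def betaDigits (n m N : ℕ) (a : ℕ → ℕ) : ℕ → ℕ :=
  fun k => if k + 1 = n + m then N else if k < n then a k else 1

/-- Digits of `β^I = [a_1,…,a_n,1,…,1,b_{n+m},b_{n+m+1},…]`: the digits of the noble number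
with the whole tail from (1-indexed) position `n+m` on replaced by the tail `b`. -/
def tailDigits (n m : ℕ) (a b : ℕ → ℕ) : ℕ → ℕ :=
  fun k => if k + 1 < n + m then (if k < n then a k else 1) else b k

namespace HasCF

variable {θ : ℝ} {a : ℕ → ℕ}

theorem alphaIter_irrational (h : HasCF θ a) (k : ℕ) : Irrational (alphaIter θ k) := by
  induction k with
  | zero => exact h.2.1
  | succ k ih =>
    rw [alphaIter, Int.fract, one_div]
    exact ih.inv.sub_intCast _

theorem alphaIter_mem_Ioo (h : HasCF θ a) (k : ℕ) : alphaIter θ k ∈ Set.Ioo (0 : ℝ) 1 := by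
  cases k with
  | zero => exact h.1
  | succ k =>
    exact ⟨lt_of_le_of_ne (Int.fract_nonneg _) (h.alphaIter_irrational (k + 1)).ne_zero.symm,
      Int.fract_lt_one _⟩

theorem one_div_alphaIter (h : HasCF θ a) (k : ℕ) :
    1 / alphaIter θ k = a k + alphaIter θ (k + 1) := by
  have h1 := Int.floor_add_fract (1 / alphaIter θ k)
  rw [h.2.2 k] at h1
  simpa [alphaIter] using h1.symm

theorem alphaIter_mul_add (h : HasCF θ a) (k : ℕ) :
    alphaIter θ k * (a k + alphaIter θ (k + 1)) = 1 := by
  rw [← h.one_div_alphaIter, mul_one_div_cancel (h.alphaIter_mem_Ioo k).1.ne']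

theorem one_le_digit (h : HasCF θ a) (k : ℕ) : 1 ≤ a k := by
  by_contra hk
  have h0 : a k = 0 := by omega
  have h1 := h.alphaIter_mul_add k
  have h2 := h.alphaIter_mem_Ioo k
  have h3 := h.alphaIter_mem_Ioo (k + 1)
  rw [h0] at h1
  push_cast at h1
  nlinarith [h2.1, h2.2, h3.1, h3.2]

theorem alphaIter_mul_alphaIter_succ_le (h : HasCF θ a) (k : ℕ) :
    alphaIter θ k * alphaIter θ (k + 1) ≤ 1 / 2 := by
  have h1 := h.alphaIter_mul_add k
  have h2 := h.alphaIter_mem_Ioo k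
  have h3 := h.alphaIter_mem_Ioo (k + 1)
  have h4 : (1 : ℝ) ≤ a k := by exact_mod_cast h.one_le_digit k
  nlinarith [h2.1, h3.2, mul_le_mul_of_nonneg_left (h3.2.le.trans h4) h2.1.le]

theorem prod_alphaIter_nonneg (h : HasCF θ a) (k : ℕ) :
    0 ≤ ∏ j ∈ Finset.range k, alphaIter θ j :=
  Finset.prod_nonneg fun j _ => (h.alphaIter_mem_Ioo j).1.le

theorem prod_alphaIter_le (h : HasCF θ a) (k : ℕ) :
    ∏ j ∈ Finset.range k, alphaIter θ j ≤ 2 * (3 / 4 : ℝ) ^ k := by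
  induction k using Nat.twoStepInduction with
  | zero => simp
  | one => simpa using (h.alphaIter_mem_Ioo 0).2.le.trans (by norm_num)
  | more k ih _ =>
    rw [Finset.prod_range_succ, Finset.prod_range_succ, mul_assoc, pow_add]
    have h1 := mul_le_mul_of_nonneg_left (h.alphaIter_mul_alphaIter_succ_le k)
      (h.prod_alphaIter_nonneg k)
    have h2 : (0 : ℝ) < (3 / 4) ^ k := by positivity
    linarith

/-- Two numbers sharing their first `N` digits: the error in the `k`-th Gauss iterate, weighted by
the preceding product, is at most the product of the first `N` iterates. -/
theorem prod_mul_abs_sub_le {β ω : ℝ} {b c : ℕ → ℕ} (hβ : HasCF β b) (hω : HasCF ω c) {N : ℕ}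
    (hbc : ∀ k < N, b k = c k) {k : ℕ} (hk : k ≤ N) :
    (∏ j ∈ Finset.range k, alphaIter β j) * |alphaIter β k - alphaIter ω k|
      ≤ ∏ j ∈ Finset.range N, alphaIter β j := by
  induction hk using Nat.decreasingInduction with
  | self =>
    refine mul_le_of_le_one_right (hβ.prod_alphaIter_nonneg N) ?_
    have h1 := hβ.alphaIter_mem_Ioo N
    have h2 := hω.alphaIter_mem_Ioo N
    exact abs_le.2 ⟨by linarith [h1.1, h2.2], by linarith [h1.2, h2.1]⟩
  | of_succ k hk ih =>
    have h1 := hβ.alphaIter_mul_add k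
    have h2 := hω.alphaIter_mul_add k
    rw [hbc k hk] at h1
    have hx := hβ.alphaIter_mem_Ioo k
    have hy := hω.alphaIter_mem_Ioo k
    have h3 : alphaIter β k - alphaIter ω k
        = -(alphaIter β k * alphaIter ω k * (alphaIter β (k + 1) - alphaIter ω (k + 1))) := by
      linear_combination alphaIter ω k * h1 - alphaIter β k * h2
    rw [h3, abs_neg, abs_mul, abs_of_pos (mul_pos hx.1 hy.1)]
    rw [Finset.prod_range_succ] at ih
    refine le_trans ?_ ih
    have h4 := mul_le_mul_of_nonneg_left hy.2.le
      (mul_nonneg (mul_nonneg (hβ.prod_alphaIter_nonneg k) hx.1.le)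
        (abs_nonneg (alphaIter β (k + 1) - alphaIter ω (k + 1))))
    linarith

theorem abs_prod_sub_prod_le {β ω : ℝ} {b c : ℕ → ℕ} (hβ : HasCF β b) (hω : HasCF ω c) {N : ℕ}
    (hbc : ∀ k < N, b k = c k) {k : ℕ} (hk : k ≤ N) :
    |∏ j ∈ Finset.range k, alphaIter β j - ∏ j ∈ Finset.range k, alphaIter ω j|
      ≤ k * ∏ j ∈ Finset.range N, alphaIter β j := by
  induction k with
  | zero => simp
  | succ k ih =>
    have hy := hω.alphaIter_mem_Ioo k
    have h1 := prod_mul_abs_sub_le hβ hω hbc (Nat.le_of_succ_le hk)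
    rw [Finset.prod_range_succ, Finset.prod_range_succ]
    set P := ∏ j ∈ Finset.range k, alphaIter β j
    set P' := ∏ j ∈ Finset.range k, alphaIter ω j
    have h2 : P * alphaIter β k - P' * alphaIter ω k
        = P * (alphaIter β k - alphaIter ω k) + (P - P') * alphaIter ω k := by ring
    rw [h2]
    refine (abs_add_le _ _).trans ?_
    rw [abs_mul, abs_mul, abs_of_nonneg (hβ.prod_alphaIter_nonneg k), abs_of_pos hy.1]
    have h3 := mul_le_of_le_one_right (abs_nonneg (P - P')) hy.2.le
    have h4 := ih (Nat.le_of_succ_le hk)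
    push_cast
    linarith

end HasCF

theorem abs_log_one_div_sub_le {x y D : ℝ} (hx : 0 < x) (hy : 0 < y) (hxD : 1 / x ≤ D)
    (hyD : 1 / y ≤ D) : |Real.log (1 / x) - Real.log (1 / y)| ≤ D * |x - y| := by
  have key : ∀ {u v : ℝ}, 0 < u → 0 < v → 1 / v ≤ D →
      Real.log u - Real.log v ≤ D * |u - v| := by
    intro u v hu hv hvD
    rw [← Real.log_div hu.ne' hv.ne']
    calc Real.log (u / v) ≤ u / v - 1 := Real.log_le_sub_one_of_pos (div_pos hu hv)
      _ = 1 / v * (u - v) := by field_simp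
      _ ≤ 1 / v * |u - v| := by gcongr; exact le_abs_self _
      _ ≤ D * |u - v| := by gcongr
  have h1 := key hx hy hyD
  have h2 := key hy hx hxD
  rw [abs_sub_comm] at h2
  rw [one_div, one_div, Real.log_inv, Real.log_inv, abs_le]
  constructor <;> linarith

/-- Brjuno head estimate for two numbers sharing their first `N` digits, all less than `D`. -/
theorem HasCF.sum_abs_brjuno_term_sub_le {β ω D : ℝ} {b c : ℕ → ℕ} (hβ : HasCF β b)
    (hω : HasCF ω c) {N : ℕ} (hbc : ∀ k < N, b k = c k) (hD : ∀ k < N, (c k : ℝ) + 1 ≤ D)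
    (hD0 : 0 ≤ D) :
    ∑ i ∈ Finset.range N,
      |(∏ j ∈ Finset.range i, alphaIter β j) * Real.log (1 / alphaIter β i)
        - (∏ j ∈ Finset.range i, alphaIter ω j) * Real.log (1 / alphaIter ω i)|
      ≤ 2 * D * ((N : ℝ) ^ 2 * (3 / 4) ^ N) := by
  have hq := hβ.prod_alphaIter_le N
  have hq0 := hβ.prod_alphaIter_nonneg N
  have term : ∀ i ∈ Finset.range N,
      |(∏ j ∈ Finset.range i, alphaIter β j) * Real.log (1 / alphaIter β i)
        - (∏ j ∈ Finset.range i, alphaIter ω j) * Real.log (1 / alphaIter ω i)|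
      ≤ N * D * ∏ j ∈ Finset.range N, alphaIter β j := by
    intro i hi
    have hiN := Finset.mem_range.1 hi
    have hx := hβ.alphaIter_mem_Ioo i
    have hy := hω.alphaIter_mem_Ioo i
    have hxD : 1 / alphaIter β i ≤ D := by
      rw [hβ.one_div_alphaIter, hbc i hiN]
      linarith [hD i hiN, (hβ.alphaIter_mem_Ioo (i + 1)).2]
    have hyD : 1 / alphaIter ω i ≤ D := by
      rw [hω.one_div_alphaIter]
      linarith [hD i hiN, (hω.alphaIter_mem_Ioo (i + 1)).2]
    have hlog := abs_log_one_div_sub_le hx.1 hy.1 hxD hyD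
    have hlogD : Real.log (1 / alphaIter ω i) ≤ D :=
      (Real.log_le_self (one_div_pos.2 hy.1).le).trans hyD
    have hlog0 : 0 ≤ Real.log (1 / alphaIter ω i) :=
      Real.log_nonneg ((one_le_div hy.1).2 hy.2.le)
    have h1 := prod_mul_abs_sub_le hβ hω hbc hiN.le
    have h2 := abs_prod_sub_prod_le hβ hω hbc hiN.le
    have hP := hβ.prod_alphaIter_nonneg i
    have hiN' : (i : ℝ) + 1 ≤ N := by exact_mod_cast hiN
    set P := ∏ j ∈ Finset.range i, alphaIter β j
    set P' := ∏ j ∈ Finset.range i, alphaIter ω j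
    set q := ∏ j ∈ Finset.range N, alphaIter β j
    set l := Real.log (1 / alphaIter β i)
    set l' := Real.log (1 / alphaIter ω i)
    calc |P * l - P' * l'| = |P * (l - l') + (P - P') * l'| := by ring_nf
      _ ≤ |P * (l - l')| + |(P - P') * l'| := abs_add_le _ _
      _ = P * |l - l'| + |P - P'| * l' := by
        rw [abs_mul, abs_mul, abs_of_nonneg hP, abs_of_nonneg hlog0]
      _ ≤ P * (D * |alphaIter β i - alphaIter ω i|) + (i * q) * D := by gcongr
      _ = D * (P * |alphaIter β i - alphaIter ω i|) + i * q * D := by ring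
      _ ≤ D * q + i * q * D := by gcongr
      _ = (i + 1) * D * q := by ring
      _ ≤ N * D * q := by gcongr
  calc _ ≤ ∑ _i ∈ Finset.range N, N * D * ∏ j ∈ Finset.range N, alphaIter β j :=
        Finset.sum_le_sum term
    _ = N * (N * D * ∏ j ∈ Finset.range N, alphaIter β j) := by simp
    _ ≤ N * (N * D * (2 * (3 / 4 : ℝ) ^ N)) := by gcongr
    _ = 2 * D * ((N : ℝ) ^ 2 * (3 / 4) ^ N) := by ring

theorem nobleDigits_add_one_le (n : ℕ) (a : ℕ → ℕ) (k : ℕ) :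
    (nobleDigits n a k : ℝ) + 1 ≤ 2 + ∑ i ∈ Finset.range n, (a i : ℝ) := by
  unfold nobleDigits
  split_ifs with hk
  · have := Finset.single_le_sum (f := fun i => (a i : ℝ)) (fun i _ => by positivity)
      (Finset.mem_range.2 hk)
    linarith
  · have : (0 : ℝ) ≤ ∑ i ∈ Finset.range n, (a i : ℝ) := by positivity
    push_cast
    linarith

/-- Lemma `auxbdtl1`, second part: the first `n+m-1` terms of the Brjuno sum of `β^I`
differ in total from those of the noble number `ω` by less than `ε`, provided `m` is
large enough, uniformly over all tails `I`. -/
theorem brjuno_head_stable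
    (n : ℕ) (a : ℕ → ℕ) (ha : ∀ i < n, 0 < a i)
    (ω : ℝ) (hω : HasCF ω (nobleDigits n a))
    (ε : ℝ) (hε : 0 < ε) :
    ∃ m₀ : ℕ, 0 < m₀ ∧ ∀ m ≥ m₀, ∀ b : ℕ → ℕ, (∀ k, 0 < b k) →
      ∀ β : ℝ, HasCF β (tailDigits n m a b) →
        ∑ i ∈ Finset.range (n + m - 1),
          |(∏ j ∈ Finset.range i, alphaIter β j) * Real.log (1 / alphaIter β i)
            - (∏ j ∈ Finset.range i, alphaIter ω j) * Real.log (1 / alphaIter ω i)| < ε := by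
  set D : ℝ := 2 + ∑ i ∈ Finset.range n, (a i : ℝ)
  have hD0 : 0 ≤ D := by positivity
  have hlim : Tendsto (fun N : ℕ => 2 * D * ((N : ℝ) ^ 2 * (3 / 4) ^ N)) atTop (nhds 0) := by
    simpa using (tendsto_pow_const_mul_const_pow_of_abs_lt_one 2
      (r := (3 / 4 : ℝ)) (by norm_num [abs_of_pos])).const_mul (2 * D)
  obtain ⟨N₀, hN₀⟩ := eventually_atTop.1 (hlim.eventually_lt_const hε)
  refine ⟨N₀ + 1, N₀.succ_pos, fun m hm b _ β hβ => ?_⟩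
  refine (hβ.sum_abs_brjuno_term_sub_le hω (fun k hk => ?_)
    (fun k _ => nobleDigits_add_one_le n a k) hD0).trans_lt (hN₀ _ (by omega))
  simp [tailDigits, nobleDigits, show k + 1 < n + m by omega]
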